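/- Let m, n be positive integers and let F be a binary image contained in {1,…,m} × {1,…,n} with row sums r_1,…,r_m and column sums c_1,…,c_n, such that r_1 = n and r_m = 0. Define b_i = #{j ∈ {1,…,n} : c_j ≥ i} and d_i = b_i − r_i for i = 1,…,m, and let L_h be the length of the horizontal boundary of F. Suppose k is an integer with 2 ≤ k ≤ m−1 such that d_k < 0 and d_{k+1} ≥ 0, and set σ = Σ_{i=1}^{k} d_i. Then for all integers t, s ≥ 0, every set {i_1 < i_2 < ⋯ < i_{2t+1}} ⊆ {1, 2, …, k−1, k, m}, and every set {ĩ_1 < ĩ_2 < ⋯ < ĩ_{2s+1}} ⊆ {1, k+1, k+2, …, m−1, m}, one has L_h ≥ 2n + (d_{i_1} − d_{i_2} + d_{i_3} − ⋯ − d_{i_{2t}} + 2·d_{i_{2t+1}}) + (d_{ĩ_1} − d_{ĩ_2} + d_{ĩ_3} − ⋯ − d_{ĩ_{2s}} + 2·d_{ĩ_{2s+1}}) − σ. -/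

import Mathlib

/-- The row sum `r i` of a binary image `F`: the number of points of `F` in row `i`. -/
def rowSum (F : Finset (ℤ × ℤ)) (i : ℤ) : ℕ := (F.filter fun p => p.1 = i).card

/-- The column sum `c j` of a binary image `F`: the number of points of `F` in column `j`. -/
def colSum (F : Finset (ℤ × ℤ)) (j : ℤ) : ℕ := (F.filter fun p => p.2 = j).card

/-- The length of the horizontal boundary of `F`: the number of pairs
`((i,j),(i',j'))` with `j = j'`, `|i - i'| = 1`, `(i,j) ∈ F` and `(i',j') ∉ F`. -/
noncomputable def horizBoundaryLen (F : Finset (ℤ × ℤ)) : ℕ :=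
  Set.ncard {q : (ℤ × ℤ) × (ℤ × ℤ) |
    q.1.2 = q.2.2 ∧ |q.1.1 - q.2.1| = 1 ∧ q.1 ∈ F ∧ q.2 ∉ F}

/-- Number of rises of `x` on `(a,b]`. -/
noncomputable def Rises (x : ℤ → ℤ) (a b : ℤ) : ℤ := ∑ i ∈ Finset.Ioc a b, max 0 (x i - x (i - 1))

lemma Rises_nonneg (x : ℤ → ℤ) (a b : ℤ) : 0 ≤ Rises x a b :=
  Finset.sum_nonneg fun _ _ => le_max_left _ _

lemma Rises_add (x : ℤ → ℤ) {a b c : ℤ} (h1 : a ≤ b) (h2 : b ≤ c) :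
    Rises x a b + Rises x b c = Rises x a c := by
  unfold Rises
  rw [← Finset.sum_union, Finset.Ioc_union_Ioc_eq_Ioc h1 h2]
  rw [Finset.disjoint_left]
  intro i hi hj
  simp only [Finset.mem_Ioc] at hi hj
  omega

lemma Ioc_succ (a b : ℤ) (h : a ≤ b) :
    Finset.Ioc a (b + 1) = insert (b + 1) (Finset.Ioc a b) := by
  ext i; simp only [Finset.mem_Ioc, Finset.mem_insert]; omega

lemma sum_Ioc_succ_int (f : ℤ → ℤ) (a b : ℤ) (h : a ≤ b) :
    ∑ i ∈ Finset.Ioc a (b + 1), f i = ∑ i ∈ Finset.Ioc a b, f i + f (b + 1) := by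
  rw [Ioc_succ a b h, Finset.sum_insert (by simp), add_comm]

lemma tele (x : ℤ → ℤ) (a b : ℤ) (h : a ≤ b) :
    ∑ i ∈ Finset.Ioc a b, (x i - x (i - 1)) = x b - x a := by
  induction b, h using Int.leInduction with
  | base => simp
  | succ b hb ih => rw [sum_Ioc_succ_int _ _ _ hb, ih]; simp

lemma Rises_ge (x : ℤ → ℤ) {a b : ℤ} (h : a ≤ b) : x b - x a ≤ Rises x a b := by
  rw [← tele x a b h]
  exact Finset.sum_le_sum fun _ _ => le_max_right _ _

lemma chain_bound (x g e : ℤ → ℤ) (he : ∀ i, e i = g i - x i) (hg : ∀ a b, a ≤ b → g b ≤ g a)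
    (t : ℕ) (idx : ℕ → ℤ) (hmono : ∀ a b : ℕ, a < b → b ≤ 2 * t → idx a < idx b) :
    ∑ u ∈ Finset.range t, (e (idx (2 * u)) - e (idx (2 * u + 1))) ≤
      g (idx 0) - g (idx (2 * t)) + Rises x (idx 0) (idx (2 * t)) := by
  induction t with
  | zero => simp [Rises]
  | succ t ih =>
    rw [Finset.sum_range_succ]
    have ih' := ih (fun a b h1 h2 => hmono a b h1 (by omega))
    have h1 : idx (2 * t) < idx (2 * t + 1) := hmono _ _ (by omega) (by omega)
    have h2 : idx (2 * t + 1) < idx (2 * (t + 1)) := hmono _ _ (by omega) (by omega)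
    have h0 : idx 0 ≤ idx (2 * t) := by
      rcases Nat.eq_zero_or_pos t with h | h
      · subst h; simp
      · exact (hmono 0 (2 * t) (by omega) (by omega)).le
    have a1 := Rises_add x h0 h1.le
    have a2 := Rises_add x (h0.trans h1.le) h2.le
    have a3 := Rises_ge x h1.le
    have a4 := Rises_nonneg x (idx (2 * t + 1)) (idx (2 * (t + 1)))
    have a5 := hg _ _ h2.le
    rw [he, he]
    linarith

lemma chain_bound_odd (x g e : ℤ → ℤ) (he : ∀ i, e i = g i - x i)
    (hg : ∀ a b, a ≤ b → g b ≤ g a)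
    (t : ℕ) (idx : ℕ → ℤ) (hmono : ∀ a b : ℕ, a < b → b ≤ 2 * t + 1 → idx a < idx b) :
    ∑ u ∈ Finset.range (t + 1), (e (idx (2 * u)) - e (idx (2 * u + 1))) ≤
      g (idx 0) - g (idx (2 * t + 1)) + Rises x (idx 0) (idx (2 * t + 1)) := by
  rw [Finset.sum_range_succ]
  have ih' := chain_bound x g e he hg t idx (fun a b h1 h2 => hmono a b h1 (by omega))
  have h1 : idx (2 * t) < idx (2 * t + 1) := hmono _ _ (by omega) (by omega)
  have h0 : idx 0 ≤ idx (2 * t) := by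
    rcases Nat.eq_zero_or_pos t with h | h
    · subst h; simp
    · exact (hmono 0 (2 * t) (by omega) (by omega)).le
  have a1 := Rises_add x h0 h1.le
  have a3 := Rises_ge x h1.le
  rw [he, he]
  linarith

/-- The indicator of `i ≤ c`. -/
def gg (c i : ℤ) : ℤ := if i ≤ c then 1 else 0

lemma gg_anti (c : ℤ) : ∀ a b, a ≤ b → gg c b ≤ gg c a := by
  intro a b h; unfold gg; split_ifs <;> omega

lemma gg_nonneg (c i : ℤ) : 0 ≤ gg c i := by unfold gg; split_ifs <;> omega
lemma gg_le (c i : ℤ) : gg c i ≤ 1 := by unfold gg; split_ifs <;> omega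

lemma sum_gg (c k M : ℤ) (hc : 0 ≤ c) (hM : 0 ≤ M) (hk : k = min c M) :
    ∑ i ∈ Finset.Icc 1 M, gg c i = k := by
  unfold gg
  rw [← Finset.sum_filter]
  have : (Finset.Icc 1 M).filter (fun i => i ≤ c) = Finset.Icc 1 k := by
    ext i; simp only [Finset.mem_filter, Finset.mem_Icc]; omega
  rw [this]
  simp
  omega

lemma c_pos (m k : ℤ) (x : ℤ → ℤ) (c : ℤ)
    (hx : ∀ i, x i = 0 ∨ x i = 1) (h1 : x 1 = 1)
    (hc : c = ∑ i ∈ Finset.Icc 1 m, x i) (hk2 : 2 ≤ k) (hkm : k ≤ m - 1) : 1 ≤ c := by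
  rw [hc]
  have := Finset.single_le_sum (f := x) (s := Finset.Icc 1 m) (a := 1)
    (fun i _ => by rcases hx i with h | h <;> omega) (by simp; omega)
  omega

lemma P_low (m : ℤ) (x : ℤ → ℤ) (c : ℤ)
    (hx : ∀ i, x i = 0 ∨ x i = 1)
    (hc : c = ∑ i ∈ Finset.Icc 1 m, x i) (l : ℤ) (hl1 : 1 ≤ l) (hlm : l ≤ m) : gg c l - x l ≤ Rises x l m := by
  by_contra hcon
  push Not at hcon
  have hR := Rises_nonneg x l m
  have hgl := gg_le c l
  have hxl : x l = 0 := by rcases hx l with h | h <;> omega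
  have hR0 : Rises x l m = 0 := by omega
  have hlc : l ≤ c := by
    by_contra h; unfold gg at hcon; rw [if_neg h] at hcon; omega
  have hz : ∀ i ∈ Finset.Icc 1 m, x i ≤ gg (l - 1) i := by
    intro i hi
    rw [Finset.mem_Icc] at hi
    unfold gg
    split_ifs with h
    · rcases hx i with h | h <;> omega
    · have a1 := Rises_add x (show l ≤ i by omega) hi.2
      have a2 := Rises_nonneg x i m
      have a3 := Rises_ge x (show l ≤ i by omega)
      omega
  have := Finset.sum_le_sum hz
  rw [← hc, sum_gg (l - 1) (l - 1) m (by omega) (by omega) (by omega)] at this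
  omega

lemma P_high (m : ℤ) (x : ℤ → ℤ) (c : ℤ)
    (hx : ∀ i, x i = 0 ∨ x i = 1)
    (hc : c = ∑ i ∈ Finset.Icc 1 m, x i) (l : ℤ) (hl1 : 1 ≤ l) (hlm : l ≤ m) (hR : Rises x 1 l = 0) : x l ≤ gg c l := by
  rcases hx l with h | h
  · rw [h]; exact gg_nonneg _ _
  have hz : ∀ i ∈ Finset.Icc 1 m, gg l i ≤ x i := by
    intro i hi
    rw [Finset.mem_Icc] at hi
    unfold gg
    split_ifs with h'
    · have a1 := Rises_add x hi.1 h'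
      have a2 := Rises_nonneg x 1 i
      have a3 := Rises_ge x h'
      omega
    · rcases hx i with h | h <;> omega
  have := Finset.sum_le_sum hz
  rw [← hc, sum_gg l l m (by omega) (by omega) (by omega)] at this
  unfold gg; rw [if_pos this]; omega

lemma no_rise (m : ℤ) (x : ℤ → ℤ) (c : ℤ)
    (hx : ∀ i, x i = 0 ∨ x i = 1)
    (hc : c = ∑ i ∈ Finset.Icc 1 m, x i) (hR : Rises x 1 m = 0) (l : ℤ) (hl1 : 1 ≤ l) (hlm : l ≤ m) : gg c l - x l = 0 := by
  have a1 := Rises_add x hl1 hlm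
  have a2 := Rises_nonneg x 1 l
  have a3 := Rises_nonneg x l m
  have a4 := P_low m x c hx hc l hl1 hlm
  have a5 := P_high m x c hx hc l hl1 hlm (by omega)
  omega

lemma column_main (m k : ℤ) (x : ℤ → ℤ) (c : ℤ)
    (hx : ∀ i, x i = 0 ∨ x i = 1) (h1 : x 1 = 1)
    (hc : c = ∑ i ∈ Finset.Icc 1 m, x i) (hk2 : 2 ≤ k) (hkm : k ≤ m - 1) (A B : ℤ)
    (h0 : (∀ l, 1 ≤ l → l ≤ m → gg c l - x l = 0) → A ≤ 0 ∧ B ≤ 0)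
    (hA : (∃ l, 1 ≤ l ∧ l ≤ k ∧ A ≤ 1 - gg c l + Rises x 1 l) ∨
      (∃ l, 1 ≤ l ∧ l < k ∧ x l = 0 ∧ l ≤ c ∧ A ≤ Rises x 1 l + 2))
    (hB : ∃ l, k + 1 ≤ l ∧ l ≤ m ∧
      B ≤ max (gg c (k + 1)) (x (k + 1)) + gg c l - 2 * x l + Rises x (k + 1) l) :
    A + B ≤ 2 * Rises x 1 m + ∑ i ∈ Finset.Icc 1 k, (gg c i - x i) := by
  have hcpos := c_pos m k x c hx h1 hc hk2 hkm
  have hx0 : ∀ i, 0 ≤ x i := fun i => by rcases hx i with h | h <;> omega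
  have hx1 : ∀ i, x i ≤ 1 := fun i => by rcases hx i with h | h <;> omega
  have hRn := Rises_nonneg x 1 m
  rcases eq_or_lt_of_le hRn with hR | hR
  · have e0 := no_rise m x c hx hc hR.symm
    have := h0 e0
    rw [Finset.sum_eq_zero (fun i hi => by
      rw [Finset.mem_Icc] at hi; exact e0 i hi.1 (by omega))]
    omega
  obtain ⟨l', hl1, hlm, hB⟩ := hB
  have split := Rises_add x (show 1 ≤ k + 1 by omega) (show k + 1 ≤ m by omega)
  have splitl := Rises_add x hl1 hlm
  have n1 := Rises_nonneg x l' m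
  have n2 := Rises_nonneg x 1 (k + 1)
  have n3 := Rises_nonneg x (k + 1) m
  have hPl := P_low m x c hx hc l' (by omega) hlm
  rcases lt_or_ge c k with hck | hck
  · -- σ = number of ones below
    have g0 : ∀ i, k ≤ i → gg c i = 0 := fun i hi => by unfold gg; rw [if_neg (by omega)]
    have hs1 : ∑ i ∈ Finset.Icc 1 k, gg c i = c := sum_gg c c k (by omega) (by omega) (by omega)
    have hs2 : c = ∑ i ∈ Finset.Icc 1 k, x i + (x (k + 1) + ∑ i ∈ Finset.Ioc (k + 1) m, x i) := by
      rw [hc, ← Finset.sum_insert (by simp), ← Finset.sum_union]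
      · congr 1
        ext i; simp only [Finset.mem_Icc, Finset.mem_union, Finset.mem_insert, Finset.mem_Ioc]; omega
      · rw [Finset.disjoint_left]
        intro i; simp only [Finset.mem_Icc, Finset.mem_insert, Finset.mem_Ioc]; omega
    have hs3 : Rises x (k + 1) m ≤ ∑ i ∈ Finset.Ioc (k + 1) m, x i :=
      Finset.sum_le_sum fun i _ => by
        have := hx0 i
        have := hx0 (i - 1)
        omega
    rw [Finset.sum_sub_distrib, hs1]
    rw [g0 (k + 1) (by omega), g0 l' (by omega)] at hB
    have := hx0 l'
    have := hx0 (k + 1)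
    have hAR : A ≤ 2 * Rises x 1 m := by
      rcases hA with ⟨l, hl1, hlk, hA⟩ | ⟨l, hl1, hlk, hxl, hlc, hA⟩
      · have := Rises_add x hl1 (show l ≤ m by omega)
        have := Rises_nonneg x l m
        have := gg_nonneg c l
        omega
      · have := Rises_add x hl1 (show l ≤ m by omega)
        have := P_low m x c hx hc l hl1 (by omega)
        have : gg c l = 1 := by unfold gg; rw [if_pos hlc]
        omega
    omega
  · have g1 : ∀ i, i ≤ k → gg c i = 1 := fun i hi => by unfold gg; rw [if_pos (by omega)]
    have hσ : ∑ i ∈ Finset.Icc 1 k, (gg c i - x i) = ∑ i ∈ Finset.Icc 1 k, (1 - x i) :=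
      Finset.sum_congr rfl fun i hi => by
        rw [Finset.mem_Icc] at hi; rw [g1 i hi.2]
    rw [hσ]
    have hnn : ∀ i ∈ Finset.Icc 1 k, 0 ≤ 1 - x i := fun i _ => by have := hx1 i; omega
    have hBR : B ≤ 1 + Rises x (k + 1) m := by
      have := hx0 l'
      have := hx1 (k + 1)
      have := gg_le c (k + 1)
      omega
    rcases hA with ⟨l, hl1, hlk, hA⟩ | ⟨l, hl1, hlk, hxl, hlc, hA⟩
    · have := Finset.sum_nonneg hnn
      have := Rises_add x hl1 (show l ≤ k + 1 by omega)
      have := Rises_nonneg x l (k + 1)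
      have := g1 l hlk
      omega
    · have hs : (1 - x l) + (1 - x k) ≤ ∑ i ∈ Finset.Icc 1 k, (1 - x i) := by
        rw [← Finset.sum_pair (f := fun i => 1 - x i) (show l ≠ k by omega)]
        refine Finset.sum_le_sum_of_subset_of_nonneg ?_ (fun i hi _ => hnn i hi)
        intro i; simp only [Finset.mem_insert, Finset.mem_singleton, Finset.mem_Icc]; omega
      have a1 := Rises_add x hl1 (show l ≤ k + 1 by omega)
      have a2 := Rises_add x (show l ≤ k by omega) (show k ≤ k + 1 by omega)
      have a3 := Rises_nonneg x k (k + 1)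
      have a4 := Rises_ge x (show l ≤ k by omega)
      have a5 := hx0 k
      have a6 := hx1 k
      omega

lemma column_bound (m k : ℤ) (x : ℤ → ℤ) (c : ℤ)
    (hx : ∀ i, x i = 0 ∨ x i = 1) (h1 : x 1 = 1) (hm : x m = 0)
    (hc : c = ∑ i ∈ Finset.Icc 1 m, x i) (hk2 : 2 ≤ k) (hkm : k ≤ m - 1) (e : ℤ → ℤ) (he : ∀ i, e i = gg c i - x i) (hem : e m = 0)
    (t s : ℕ)
    (idx : ℕ → ℤ)
    (hidx_mono : ∀ a b : ℕ, a < b → b ≤ 2 * t → idx a < idx b)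
    (hidx_range : ∀ u : ℕ, u ≤ 2 * t → idx u ∈ insert m (Finset.Icc (1 : ℤ) k))
    (tidx : ℕ → ℤ)
    (htidx_mono : ∀ a b : ℕ, a < b → b ≤ 2 * s → tidx a < tidx b)
    (htidx_range : ∀ u : ℕ, u ≤ 2 * s → tidx u ∈ insert (1 : ℤ) (Finset.Icc (k + 1) m)) :
    (∑ u ∈ Finset.range t, (e (idx (2 * u)) - e (idx (2 * u + 1)))
        + (if idx (2 * t) = k then 0 else 2 * e (idx (2 * t))))
      + (∑ u ∈ Finset.range s, (e (tidx (2 * u)) - e (tidx (2 * u + 1)))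
        + 2 * e (tidx (2 * s)))
      ≤ 2 * Rises x 1 m + ∑ i ∈ Finset.Icc 1 k, e i := by
  have hcpos := c_pos m k x c hx h1 hc hk2 hkm
  have hx0 : ∀ i, 0 ≤ x i := fun i => by rcases hx i with h | h <;> omega
  have hx1 : ∀ i, x i ≤ 1 := fun i => by rcases hx i with h | h <;> omega
  have hg1 : gg c 1 = 1 := by unfold gg; rw [if_pos hcpos]
  have he1 : e 1 = 0 := by rw [he, hg1, h1]; rfl
  simp only [Finset.mem_insert, Finset.mem_Icc] at hidx_range htidx_range
  have hs : ∑ i ∈ Finset.Icc 1 k, e i = ∑ i ∈ Finset.Icc 1 k, (gg c i - x i) :=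
    Finset.sum_congr rfl fun i _ => he i
  rw [hs]
  have ext1 : ∀ a l, 1 ≤ a → a ≤ l → Rises x a l ≤ Rises x 1 l := fun a l h h' => by
    have := Rises_add x h h'
    have := Rises_nonneg x 1 a
    omega
  apply column_main m k x c hx h1 hc hk2 hkm
  · intro h0
    have hi : ∀ u, u ≤ 2 * t → e (idx u) = 0 := fun u hu => by
      rw [he]; have := hidx_range u hu; apply h0 <;> omega
    have ht : ∀ u, u ≤ 2 * s → e (tidx u) = 0 := fun u hu => by
      rw [he]; have := htidx_range u hu; apply h0 <;> omega
    rw [hi _ le_rfl, ht _ le_rfl, Finset.sum_eq_zero, Finset.sum_eq_zero]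
    · simp
    · intro u hu; rw [Finset.mem_range] at hu; rw [ht _ (by omega), ht _ (by omega)]; rfl
    · intro u hu; rw [Finset.mem_range] at hu; rw [hi _ (by omega), hi _ (by omega)]; rfl
  · by_cases hlast : idx (2 * t) = k ∨ idx (2 * t) = m
    · left
      have : (if idx (2 * t) = k then 0 else 2 * e (idx (2 * t))) = 0 := by
        split_ifs with h
        · rfl
        · rw [hlast.resolve_left h, hem]; rfl
      rw [this, add_zero]
      cases t with
      | zero =>
        refine ⟨1, le_rfl, by omega, ?_⟩
        simp [hg1, Rises_nonneg]
      | succ t =>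
        have hlt := hidx_mono (2 * t + 1) (2 * (t + 1)) (by omega) (by omega)
        have hr := hidx_range (2 * t + 1) (by omega)
        have hr0 := hidx_range 0 (by omega)
        have h01 := hidx_mono 0 (2 * t + 1) (by omega) (by omega)
        have hb := chain_bound_odd x (gg c) e he (gg_anti c) t idx
          (fun a b h h' => hidx_mono a b h (by omega))
        refine ⟨idx (2 * t + 1), by omega, by omega, hb.trans ?_⟩
        have := ext1 (idx 0) (idx (2 * t + 1)) (by omega) (by omega)
        have := gg_le c (idx 0)
        omega
    · push Not at hlast
      rw [if_neg hlast.1]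
      have hr := hidx_range (2 * t) le_rfl
      have hr0 := hidx_range 0 (by omega)
      have h01 : idx 0 ≤ idx (2 * t) := by
        rcases Nat.eq_zero_or_pos t with h | h
        · subst h; simp
        · exact (hidx_mono 0 (2 * t) (by omega) (by omega)).le
      have hb := chain_bound x (gg c) e he (gg_anti c) t idx hidx_mono
      have b1 := ext1 (idx 0) (idx (2 * t)) (by omega) (by omega)
      have b2 := gg_le c (idx 0)
      have b3 := gg_le c (idx (2 * t))
      have b4 := he (idx (2 * t))
      have b5 := hx0 (idx (2 * t))
      by_cases hp : e (idx (2 * t)) ≤ 0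
      · left
        exact ⟨idx (2 * t), by omega, by omega, by omega⟩
      · right
        refine ⟨idx (2 * t), by omega, by omega, by omega, ?_, by omega⟩
        by_contra h
        unfold gg at b4
        rw [if_neg h] at b4
        omega
  · have htl : 1 ≤ tidx (2 * s) := by have := htidx_range (2 * s) le_rfl; omega
    rcases htidx_range 0 (by omega) with h | h
    · cases s with
      | zero =>
        refine ⟨m, by omega, le_rfl, ?_⟩
        have := gg_nonneg c (k + 1)
        have := gg_nonneg c m
        have := Rises_nonneg x (k + 1) m
        simp only [Finset.range_zero, Finset.sum_empty, Nat.mul_zero, h, he1, hm]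
        omega
      | succ s =>
        have hb := chain_bound x (gg c) e he (gg_anti c) s (fun u => tidx (u + 2))
          (fun a b h h' => htidx_mono _ _ (by omega) (by omega))
        have h2 : 2 * (s + 1) = 2 * s + 2 := by ring
        rw [h2] at htl htidx_mono htidx_range ⊢
        have m1 := htidx_mono 0 1 (by omega) (by omega)
        have m2 := htidx_mono 1 2 (by omega) (by omega)
        have m3 : tidx 2 ≤ tidx (2 * s + 2) := by
          rcases Nat.eq_zero_or_pos s with h | h
          · subst h; simp
          · exact (htidx_mono 2 (2 * s + 2) (by omega) (by omega)).le
        have r1 := htidx_range 1 (by omega)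
        have r2 := htidx_range 2 (by omega)
        have r3 := htidx_range (2 * s + 2) (by omega)
        refine ⟨tidx (2 * s + 2), by omega, by omega, ?_⟩
        rw [Finset.sum_range_succ']
        have heq : ∑ u ∈ Finset.range s, (e (tidx (2 * (u + 1))) - e (tidx (2 * (u + 1) + 1)))
          = ∑ u ∈ Finset.range s, (e (tidx (2 * u + 2)) - e (tidx (2 * u + 1 + 2))) :=
          Finset.sum_congr rfl fun u _ => by
            rw [show 2 * (u + 1) = 2 * u + 2 by ring, show 2 * u + 2 + 1 = 2 * u + 1 + 2 by ring]
        rw [heq]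
        simp only [Nat.mul_zero, zero_add, h, he1] at hb ⊢
        have e1 := he (tidx 1)
        have e2 := he (tidx (2 * s + 2))
        have a1 := Rises_add x (show k + 1 ≤ tidx 1 by omega) m2.le
        have a2 := Rises_add x (show k + 1 ≤ tidx 2 by omega) m3
        have a3 := Rises_ge x (show k + 1 ≤ tidx 1 by omega)
        have a4 := Rises_nonneg x (tidx 1) (tidx 2)
        have a5 := gg_anti c _ _ m2.le
        omega
    · have hb := chain_bound x (gg c) e he (gg_anti c) s tidx htidx_mono
      have h01 : tidx 0 ≤ tidx (2 * s) := by
        rcases Nat.eq_zero_or_pos s with h | h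
        · subst h; simp
        · exact (htidx_mono 0 (2 * s) (by omega) (by omega)).le
      have r3 := htidx_range (2 * s) (by omega)
      refine ⟨tidx (2 * s), by omega, by omega, ?_⟩
      have e2 := he (tidx (2 * s))
      have a1 := Rises_add x h.1 h01
      have a4 := Rises_nonneg x (k + 1) (tidx 0)
      have a5 := gg_anti c _ _ h.1
      omega

/-- Indicator of the image. -/
def X (F : Finset (ℤ × ℤ)) (j i : ℤ) : ℤ := if (i, j) ∈ F then 1 else 0

lemma colSum_eq (m n : ℕ) (F : Finset (ℤ × ℤ))
    (hF : ∀ p ∈ F, p.1 ∈ Finset.Icc (1 : ℤ) (m : ℤ) ∧ p.2 ∈ Finset.Icc (1 : ℤ) (n : ℤ)) (j : ℤ) :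
    (colSum F j : ℤ) = ∑ i ∈ Finset.Icc (1 : ℤ) m, X F j i := by
  unfold colSum X
  rw [← Finset.sum_filter, Finset.sum_const, nsmul_eq_mul, mul_one]
  congr 1
  refine Finset.card_bij (fun p _ => p.1) ?_ ?_ ?_
  · rintro ⟨a, b⟩ h
    simp only [Finset.mem_filter] at h ⊢
    obtain ⟨h, rfl⟩ := h
    exact ⟨(hF _ h).1, h⟩
  · rintro ⟨a, b⟩ h ⟨a', b'⟩ h' hh
    simp only [Finset.mem_filter] at h h' hh
    rw [hh, h.2, h'.2]
  · intro i hi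
    simp only [Finset.mem_filter] at hi
    exact ⟨(i, j), by simp [hi.2], rfl⟩

lemma rowSum_eq (m n : ℕ) (F : Finset (ℤ × ℤ))
    (hF : ∀ p ∈ F, p.1 ∈ Finset.Icc (1 : ℤ) (m : ℤ) ∧ p.2 ∈ Finset.Icc (1 : ℤ) (n : ℤ)) (i : ℤ) :
    (rowSum F i : ℤ) = ∑ j ∈ Finset.Icc (1 : ℤ) n, X F j i := by
  unfold rowSum X
  rw [← Finset.sum_filter, Finset.sum_const, nsmul_eq_mul, mul_one]
  congr 1
  refine Finset.card_bij (fun p _ => p.2) ?_ ?_ ?_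
  · rintro ⟨a, b⟩ h
    simp only [Finset.mem_filter] at h ⊢
    obtain ⟨h, rfl⟩ := h
    exact ⟨(hF _ h).2, h⟩
  · rintro ⟨a, b⟩ h ⟨a', b'⟩ h' hh
    simp only [Finset.mem_filter] at h h' hh
    rw [hh, h.2, h'.2]
  · intro j hj
    simp only [Finset.mem_filter] at hj
    exact ⟨(i, j), by simp [hj.2], rfl⟩

lemma boundary_ge (m n : ℕ) (F : Finset (ℤ × ℤ)) :
    ∑ j ∈ Finset.Icc (1 : ℤ) n, ∑ i ∈ Finset.Ioc (0 : ℤ) m,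
      (max 0 (X F j i - X F j (i - 1)) + max 0 (X F j (i - 1) - X F j i))
      ≤ (horizBoundaryLen F : ℤ) := by
  classical
  set S : Set ((ℤ × ℤ) × (ℤ × ℤ)) := {q | q.1.2 = q.2.2 ∧ |q.1.1 - q.2.1| = 1 ∧ q.1 ∈ F ∧ q.2 ∉ F}
    with hS
  have hfin : S.Finite := by
    refine Set.Finite.subset (Finset.finite_toSet (F ×ˢ
      (F.image (fun p => (p.1 + 1, p.2)) ∪ F.image (fun p => (p.1 - 1, p.2))))) ?_
    rintro ⟨⟨a, b⟩, ⟨a', b'⟩⟩ ⟨h1, h2, h3, h4⟩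
    simp only at h1 h2 h3 h4
    subst h1
    simp only [Finset.coe_product, Set.mem_prod, Finset.mem_coe, Finset.mem_union,
      Finset.mem_image, h3, true_and]
    rcases (abs_eq (by norm_num)).1 h2 with h | h
    · right; exact ⟨(a, b), h3, by simp; omega⟩
    · left; exact ⟨(a, b), h3, by simp; omega⟩
  set P := Finset.Icc (1 : ℤ) n ×ˢ Finset.Ioc (0 : ℤ) m with hP
  set T1 := (P.filter (fun p => (p.2, p.1) ∈ F ∧ (p.2 - 1, p.1) ∉ F)).image
    (fun p => ((p.2, p.1), (p.2 - 1, p.1))) with hT1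
  set T2 := (P.filter (fun p => (p.2 - 1, p.1) ∈ F ∧ (p.2, p.1) ∉ F)).image
    (fun p => ((p.2 - 1, p.1), (p.2, p.1))) with hT2
  have hdis : Disjoint T1 T2 := by
    rw [Finset.disjoint_left]
    intro q h1 h2
    rw [hT1, Finset.mem_image] at h1
    rw [hT2, Finset.mem_image] at h2
    obtain ⟨⟨a, b⟩, -, rfl⟩ := h1
    obtain ⟨⟨a', b'⟩, -, h⟩ := h2
    simp only [Prod.mk.injEq] at h
    omega
  have hsub : ((T1 ∪ T2 : Finset _) : Set ((ℤ × ℤ) × (ℤ × ℤ))) ⊆ S := by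
    intro q hq
    rw [Finset.mem_coe, Finset.mem_union, hT1, hT2, Finset.mem_image, Finset.mem_image] at hq
    rcases hq with ⟨⟨a, b⟩, h, rfl⟩ | ⟨⟨a, b⟩, h, rfl⟩
    · rw [Finset.mem_filter] at h
      exact ⟨rfl, by simp, h.2.1, h.2.2⟩
    · rw [Finset.mem_filter] at h
      exact ⟨rfl, by simp, h.2.1, h.2.2⟩
  have hle := Set.ncard_le_ncard hsub hfin
  rw [Set.ncard_coe_finset, Finset.card_union_of_disjoint hdis, hT1, hT2,
    Finset.card_image_of_injective, Finset.card_image_of_injective] at hle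
  · have : (horizBoundaryLen F : ℤ) = (S.ncard : ℤ) := rfl
    rw [this]
    refine le_trans (le_of_eq ?_) (Int.ofNat_le.2 hle)
    rw [← Finset.sum_product', Finset.sum_add_distrib]
    push_cast [Finset.card_filter]
    congr 1
    · refine Finset.sum_congr rfl fun p _ => ?_
      unfold X
      by_cases h1 : (p.2, p.1) ∈ F <;> by_cases h2 : (p.2 - 1, p.1) ∈ F <;> simp [h1, h2]
    · refine Finset.sum_congr rfl fun p _ => ?_
      unfold X
      by_cases h1 : (p.2, p.1) ∈ F <;> by_cases h2 : (p.2 - 1, p.1) ∈ F <;> simp [h1, h2]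
  · rintro ⟨a, b⟩ ⟨a', b'⟩ h
    simp only [Prod.mk.injEq] at h ⊢
    omega
  · rintro ⟨a, b⟩ ⟨a', b'⟩ h
    simp only [Prod.mk.injEq] at h ⊢
    omega

lemma col_boundary (m : ℤ) (x : ℤ → ℤ) (h0 : x 0 = 0) (h1 : x 1 = 1) (hm : x m = 0) (hm1 : 1 ≤ m) :
    ∑ i ∈ Finset.Ioc (0 : ℤ) m, (max 0 (x i - x (i - 1)) + max 0 (x (i - 1) - x i))
      = 2 + 2 * Rises x 1 m := by
  have h : ∑ i ∈ Finset.Ioc (0 : ℤ) m, (max 0 (x i - x (i - 1)) + max 0 (x (i - 1) - x i))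
      = ∑ i ∈ Finset.Ioc (0 : ℤ) m, (2 * max 0 (x i - x (i - 1)) - (x i - x (i - 1))) :=
    Finset.sum_congr rfl fun i _ => by omega
  rw [h, Finset.sum_sub_distrib, tele x 0 m (by omega), ← Finset.mul_sum]
  have h2 : Rises x 0 m = 1 + Rises x 1 m := by
    rw [← Rises_add x (show (0 : ℤ) ≤ 1 by omega) hm1]
    congr 1
    unfold Rises
    have : Finset.Ioc (0 : ℤ) 1 = {1} := by ext i; simp; omega
    rw [this]; simp [h0, h1]
  unfold Rises at h2 ⊢
  rw [h2, h0, hm]; ring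

/-- Theorem 2 (the variation): with `d_k < 0`, `d_{k+1} ≥ 0` and `σ = Σ_{i=1}^k d_i`,
for any indices `i_1 < ⋯ < i_{2t+1}` from `{1, …, k, m}` and
`ĩ_1 < ⋯ < ĩ_{2s+1}` from `{1, k+1, …, m-1, m}` we have
`L_h ≥ 2n + (d_{i_1} - d_{i_2} + ⋯ - d_{i_{2t}} + 2 d_{i_{2t+1}})
        + (d_{ĩ_1} - d_{ĩ_2} + ⋯ - d_{ĩ_{2s}} + 2 d_{ĩ_{2s+1}}) - σ`.
Here `idx 0, …, idx (2t)` play the role of `i_1 < ⋯ < i_{2t+1}` and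
`tidx 0, …, tidx (2s)` the role of `ĩ_1 < ⋯ < ĩ_{2s+1}`. -/
theorem boundary_lower_bound_split (m n : ℕ) (hm : 0 < m) (hn : 0 < n)
    (F : Finset (ℤ × ℤ))
    (hF : ∀ p ∈ F, p.1 ∈ Finset.Icc (1 : ℤ) (m : ℤ) ∧ p.2 ∈ Finset.Icc (1 : ℤ) (n : ℤ))
    (hr1 : rowSum F 1 = n) (hrm : rowSum F (m : ℤ) = 0)
    (b : ℤ → ℕ)
    (hb : ∀ i : ℤ, b i = ((Finset.Icc (1 : ℤ) (n : ℤ)).filter fun j => i ≤ (colSum F j : ℤ)).card)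
    (d : ℤ → ℤ) (hd : ∀ i : ℤ, d i = (b i : ℤ) - (rowSum F i : ℤ))
    (k : ℤ) (hk2 : 2 ≤ k) (hkm : k ≤ (m : ℤ) - 1)
    (hdk : d k < 0) (hdk1 : 0 ≤ d (k + 1))
    (σ : ℤ) (hσ : σ = ∑ i ∈ Finset.Icc (1 : ℤ) k, d i)
    (t s : ℕ)
    (idx : ℕ → ℤ)
    (hidx_mono : ∀ a b : ℕ, a < b → b ≤ 2 * t → idx a < idx b)
    (hidx_range : ∀ u : ℕ, u ≤ 2 * t → idx u ∈ insert (m : ℤ) (Finset.Icc (1 : ℤ) k))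
    (tidx : ℕ → ℤ)
    (htidx_mono : ∀ a b : ℕ, a < b → b ≤ 2 * s → tidx a < tidx b)
    (htidx_range : ∀ u : ℕ, u ≤ 2 * s → tidx u ∈ insert (1 : ℤ) (Finset.Icc (k + 1) (m : ℤ))) :
    (horizBoundaryLen F : ℤ) ≥
      2 * n
        + ((∑ u ∈ Finset.range t, (d (idx (2 * u)) - d (idx (2 * u + 1))))
            + 2 * d (idx (2 * t)))
        + ((∑ u ∈ Finset.range s, (d (tidx (2 * u)) - d (tidx (2 * u + 1))))
            + 2 * d (tidx (2 * s)))
        - σ := by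
  clear hdk1 hn
  have hX01 : ∀ j i, X F j i = 0 ∨ X F j i = 1 := fun j i => by
    unfold X; split_ifs <;> simp
  have hXout : ∀ j i, i ∉ Finset.Icc (1 : ℤ) m → X F j i = 0 := fun j i h => by
    unfold X; rw [if_neg]; exact fun h' => h (hF _ h').1
  have hX1 : ∀ j ∈ Finset.Icc (1 : ℤ) n, X F j 1 = 1 := by
    have h := rowSum_eq m n F hF 1
    rw [hr1] at h
    have h' : ∑ j ∈ Finset.Icc (1 : ℤ) n, (1 - X F j 1) = 0 := by
      rw [Finset.sum_sub_distrib, ← h]; simp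
    rw [Finset.sum_eq_zero_iff_of_nonneg (fun j _ => by rcases hX01 j 1 with h | h <;> omega)] at h'
    intro j hj
    have := h' j hj
    omega
  have hXm : ∀ j ∈ Finset.Icc (1 : ℤ) n, X F j m = 0 := by
    have h := rowSum_eq m n F hF m
    rw [hrm] at h
    have h' := h.symm
    push_cast at h'
    rw [Finset.sum_eq_zero_iff_of_nonneg
      (fun j _ => by rcases hX01 j m with h | h <;> omega)] at h'
    exact h'
  set e : ℤ → ℤ → ℤ := fun j i => gg (colSum F j) i - X F j i with he
  have hde : ∀ i, d i = ∑ j ∈ Finset.Icc (1 : ℤ) n, e j i := by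
    intro i
    rw [hd, hb, rowSum_eq m n F hF, he, Finset.sum_sub_distrib]
    congr 1
    push_cast [Finset.card_filter]
    rfl
  have hem : ∀ j ∈ Finset.Icc (1 : ℤ) n, e j m = 0 := by
    intro j hj
    have hlt : (colSum F j : ℤ) < m := by
      rw [colSum_eq m n F hF]
      have : ∑ i ∈ Finset.Icc (1 : ℤ) m, X F j i < ∑ i ∈ Finset.Icc (1 : ℤ) m, (1 : ℤ) := by
        refine Finset.sum_lt_sum (fun i _ => by rcases hX01 j i with h | h <;> omega)
          ⟨m, by simp; omega, by rw [hXm j hj]; norm_num⟩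
      simpa using this
    simp only [he, hXm j hj, gg]
    rw [if_neg (by omega)]; rfl
  have hcol : ∀ j ∈ Finset.Icc (1 : ℤ) n, _ := fun j hj =>
    column_bound (m : ℤ) k (X F j) (colSum F j) (hX01 j) (hX1 j hj) (hXm j hj)
      (colSum_eq m n F hF j) hk2 hkm (e j) (fun i => rfl) (hem j hj) t s idx hidx_mono hidx_range
      tidx htidx_mono htidx_range
  have hsum := Finset.sum_le_sum hcol
  have hL := boundary_ge m n F
  rw [Finset.sum_congr rfl (fun j hj => col_boundary (m : ℤ) (X F j)
    (hXout j 0 (by simp)) (hX1 j hj) (hXm j hj) (by omega))] at hL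
  rw [Finset.sum_add_distrib, Finset.sum_add_distrib, Finset.sum_add_distrib,
    Finset.sum_add_distrib, Finset.sum_comm, Finset.sum_comm (t := Finset.range s),
    Finset.sum_comm (t := Finset.Icc 1 k)] at hsum
  simp only [Finset.sum_sub_distrib, ← hde, ← Finset.mul_sum] at hsum
  rw [← hσ] at hsum
  have hlast : 2 * d (idx (2 * t)) ≤
      ∑ j ∈ Finset.Icc (1 : ℤ) n, (if idx (2 * t) = k then 0 else 2 * e j (idx (2 * t))) := by
    split_ifs with h
    · rw [h]; simp; omega
    · rw [← Finset.mul_sum, ← hde]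
  rw [Finset.sum_add_distrib, ← Finset.mul_sum] at hL
  simp only [Finset.sum_const, Int.card_Icc, nsmul_eq_mul] at hL
  simp only [Finset.sum_sub_distrib]
  have hn' : (((n : ℤ) + 1 - 1).toNat : ℤ) = n := by omega
  rw [hn'] at hL
  linarith
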